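/- The quotient P(V_{2,3})/(SL₂(ℂ)×SL₂(ℂ)) is rational: the field of SL₂×SL₂-invariant rational functions on the 11-dimensional projective space P(V_{2,3}) of bidegree (2,3) biforms is a purely transcendental extension of ℂ of transcendence degree 5. -/

import Mathlib

set_option synthInstance.maxHeartbeats 1000000
set_option maxHeartbeats 1000000
noncomputable section
open MvPolynomial

/-- The field of invariant rational functions: the subfield of the fraction field of `R`
consisting of elements fixed by a family of `ℂ`-algebra endomorphisms of `R`. -/
def invariantField (R : Type*) [CommRing R] [IsDomain R] [Algebra ℂ R]
    {ι : Type*} (φ : ι → (R →ₐ[ℂ] R)) : IntermediateField ℂ (FractionRing R) where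
  carrier := {x | ∃ f g : R, g ≠ 0 ∧
      x = algebraMap R (FractionRing R) f / algebraMap R (FractionRing R) g ∧
      ∀ i, φ i f * g = φ i g * f}
  mul_mem' := by
    rintro x y ⟨f, g, hg, rfl, hf⟩ ⟨p, q, hq, rfl, hp⟩
    exact ⟨f * p, g * q, mul_ne_zero hg hq,
      by rw [map_mul, map_mul, div_mul_div_comm],
      fun i => by
        simp only [map_mul]
        linear_combination (φ i p * q) * hf i + (φ i g * f) * hp i⟩
  one_mem' := ⟨1, 1, one_ne_zero, by simp, fun i => rfl⟩
  add_mem' := by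
    rintro x y ⟨f, g, hg, rfl, hf⟩ ⟨p, q, hq, rfl, hp⟩
    have hg' : algebraMap R (FractionRing R) g ≠ 0 :=
      fun h => hg ((map_eq_zero_iff _ (IsFractionRing.injective R (FractionRing R))).mp h)
    have hq' : algebraMap R (FractionRing R) q ≠ 0 :=
      fun h => hq ((map_eq_zero_iff _ (IsFractionRing.injective R (FractionRing R))).mp h)
    refine ⟨f * q + g * p, g * q, mul_ne_zero hg hq, ?_, fun i => ?_⟩
    · rw [map_add, map_mul, map_mul, map_mul, div_add_div _ _ hg' hq']
    · simp only [map_add, map_mul]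
      linear_combination (φ i q * q) * hf i + (φ i g * g) * hp i
  zero_mem' := ⟨0, 1, one_ne_zero, by simp, fun i => by simp⟩
  algebraMap_mem' := fun c =>
    ⟨algebraMap ℂ R c, 1, one_ne_zero,
      by rw [map_one, div_one, ← IsScalarTower.algebraMap_apply],
      fun i => by simp [AlgHom.commutes]⟩
  inv_mem' := by
    rintro x ⟨f, g, hg, rfl, hf⟩
    by_cases hf0 : f = 0
    · exact ⟨0, 1, one_ne_zero, by simp [hf0], fun i => by simp⟩
    · exact ⟨g, f, hf0, by rw [inv_div], fun i => (hf i).symm⟩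

abbrev SL2 := Matrix.SpecialLinearGroup (Fin 2) ℂ

/-- The action of `SL₂(ℂ)` on binary forms by linear substitution of the variables. -/
def sub1 (g : SL2) : MvPolynomial (Fin 2) ℂ →ₐ[ℂ] MvPolynomial (Fin 2) ℂ :=
  aeval fun i => ∑ j, C (g.1 i j) * X j

/-- The matrix of the action of `g` on `V_d` in the basis of monomials `X^i Y^(d-i)`. -/
def repMat (d : ℕ) (g : SL2) (i j : Fin (d + 1)) : ℂ :=
  coeff (Finsupp.single 0 (i : ℕ) + Finsupp.single 1 (d - (i : ℕ)))
    (sub1 g (X 0 ^ (j : ℕ) * X 1 ^ (d - (j : ℕ))))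

/-- The endomorphism of the coordinate ring of `V_{a,b} = V_a ⊗ V_b` induced by
`(g, h) ∈ SL₂ × SL₂` together with the scaling by `t` (so that invariance under the
scalings expresses that a rational function descends to the projectivization). -/
def coordHomAB (a b : ℕ) (g h : SL2) (t : ℂˣ) :
    MvPolynomial (Fin (a + 1) × Fin (b + 1)) ℂ →ₐ[ℂ]
      MvPolynomial (Fin (a + 1) × Fin (b + 1)) ℂ :=
  aeval fun p => (t : ℂ) • ∑ q, C (repMat a g p.1 q.1 * repMat b h p.2 q.2) * X q

/-- The field `ℂ(P(V_{a,b}))^{SL₂×SL₂}` of `SL₂(ℂ) × SL₂(ℂ)`-invariant rational functions on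
the projective space of biforms of bidegree `(a,b)`, realized as the field of rational
functions in the coefficient coordinates (indexed by `Fin (a+1) × Fin (b+1)`) that are
invariant under the induced linear action and under scaling. -/
def invFieldAB (a b : ℕ) :
    IntermediateField ℂ (FractionRing (MvPolynomial (Fin (a + 1) × Fin (b + 1)) ℂ)) :=
  invariantField _ fun γ : SL2 × SL2 × ℂˣ => coordHomAB a b γ.1 γ.2.1 γ.2.2


section helpers
variable {R : Type*} [CommRing R]

def qgram (x : Fin 3 × Fin 4 → R) (j k : Fin 4) : R :=
  x (1, j) * x (1, k) - 2 * (x (2, j) * x (0, k) + x (0, j) * x (2, k))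

def qdet (x : Fin 3 × Fin 4 → R) (j k l : Fin 4) : R :=
  x (0, j) * (x (1, k) * x (2, l) - x (1, l) * x (2, k))
  - x (0, k) * (x (1, j) * x (2, l) - x (1, l) * x (2, j))
  + x (0, l) * (x (1, j) * x (2, k) - x (1, k) * x (2, j))

def qker (x : Fin 3 × Fin 4 → R) : Fin 4 → R :=
  ![-qdet x 1 2 3, qdet x 0 2 3, -qdet x 0 1 3, qdet x 0 1 2]

def qsym2 (h : Matrix (Fin 2) (Fin 2) R) : Fin 3 → Fin 3 → R :=
  ![![h 1 1 ^ 2, h 0 1 * h 1 1, h 0 1 ^ 2],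
    ![2 * h 1 0 * h 1 1, h 0 0 * h 1 1 + h 0 1 * h 1 0, 2 * h 0 0 * h 0 1],
    ![h 1 0 ^ 2, h 0 0 * h 1 0, h 0 0 ^ 2]]

def qsym3 (h : Matrix (Fin 2) (Fin 2) R) : Fin 4 → Fin 4 → R :=
  ![![h 1 1 ^ 3, h 0 1 * h 1 1 ^ 2, h 0 1 ^ 2 * h 1 1, h 0 1 ^ 3],
    ![3 * h 1 0 * h 1 1 ^ 2, h 0 0 * h 1 1 ^ 2 + 2 * h 0 1 * h 1 0 * h 1 1,
      2 * h 0 0 * h 0 1 * h 1 1 + h 0 1 ^ 2 * h 1 0, 3 * h 0 0 * h 0 1 ^ 2],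
    ![3 * h 1 0 ^ 2 * h 1 1, 2 * h 0 0 * h 1 0 * h 1 1 + h 0 1 * h 1 0 ^ 2,
      h 0 0 ^ 2 * h 1 1 + 2 * h 0 0 * h 0 1 * h 1 0, 3 * h 0 0 ^ 2 * h 0 1],
    ![h 1 0 ^ 3, h 0 0 * h 1 0 ^ 2, h 0 0 ^ 2 * h 1 0, h 0 0 ^ 3]]

def qdt (h : Matrix (Fin 2) (Fin 2) R) : R := h 0 0 * h 1 1 - h 0 1 * h 1 0

def qL (g : Matrix (Fin 2) (Fin 2) R) (x : Fin 3 × Fin 4 → R) : Fin 3 × Fin 4 → R :=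
  fun p => ∑ i, qsym2 g p.1 i * x (i, p.2)

def qA (S : Fin 4 → Fin 4 → R) (x : Fin 3 × Fin 4 → R) : Fin 3 × Fin 4 → R :=
  fun p => ∑ j, S p.2 j * x (p.1, j)

def qR (h : Matrix (Fin 2) (Fin 2) R) (x : Fin 3 × Fin 4 → R) : Fin 3 × Fin 4 → R :=
  qA (qsym3 h) x

def qm (x : Fin 3 × Fin 4 → R) : Fin 3 → R :=
  ![3 * qgram x 0 2 - qgram x 1 1, 9 * qgram x 0 3 - qgram x 1 2, 3 * qgram x 1 3 - qgram x 2 2]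

def ql (x : Fin 3 × Fin 4 → R) : Fin 2 → R :=
  ![qm x 2 * qker x 3 + qm x 1 * qker x 2 + qm x 0 * qker x 1,
    qm x 2 * qker x 2 + qm x 1 * qker x 1 + qm x 0 * qker x 0]

def qp (x : Fin 3 × Fin 4 → R) : Fin 2 → R :=
  ![-(qm x 1 * ql x 0 + 2 * qm x 0 * ql x 1), 2 * qm x 2 * ql x 0 + qm x 1 * ql x 1]

def qF (x : Fin 3 × Fin 4 → R) : Matrix (Fin 2) (Fin 2) R :=
  !![ql x 0, qp x 0; ql x 1, qp x 1]

def qZ (x : Fin 3 × Fin 4 → R) : Fin 3 × Fin 4 → R := qR (qF x) x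

/-- numerators -/
def qn (x : Fin 3 × Fin 4 → R) : Fin 5 → R :=
  ![qker (qZ x) 1 * qker (qZ x) 3, qgram (qZ x) 0 0 * qker (qZ x) 2 ^ 2,
    qgram (qZ x) 0 1 * qker (qZ x) 2, qgram (qZ x) 0 2, qm (qZ x) 2 * qker (qZ x) 3 ^ 2]

/-- denominators -/
def qd (x : Fin 3 × Fin 4 → R) : Fin 5 → R :=
  ![qker (qZ x) 2 ^ 2, qm (qZ x) 0 * qker (qZ x) 3 ^ 2,
    qm (qZ x) 0 * qker (qZ x) 3, qm (qZ x) 0, qm (qZ x) 0 * qker (qZ x) 2 ^ 2]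

/-! naturality -/
section nat
variable {S : Type*} [CommRing S] (f : R →+* S) (x : Fin 3 × Fin 4 → R)

lemma qgram_map (j k) : f (qgram x j k) = qgram (fun p => f (x p)) j k := by
  simp [qgram, map_ofNat]
lemma qdet_map (j k l) : f (qdet x j k l) = qdet (fun p => f (x p)) j k l := by
  simp [qdet]
lemma qker_map (j) : f (qker x j) = qker (fun p => f (x p)) j := by
  fin_cases j <;> simp [qker, qdet_map]
lemma qm_map (j) : f (qm x j) = qm (fun p => f (x p)) j := by
  fin_cases j <;> simp [qm, qgram_map, map_ofNat]
lemma ql_map (j) : f (ql x j) = ql (fun p => f (x p)) j := by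
  fin_cases j <;> simp [ql, qm_map, qker_map]
lemma qp_map (j) : f (qp x j) = qp (fun p => f (x p)) j := by
  fin_cases j <;> simp [qp, qm_map, ql_map, map_ofNat]
lemma qF_map (i j) : f (qF x i j) = qF (fun p => f (x p)) i j := by
  fin_cases i <;> fin_cases j <;> simp [qF, qp_map, ql_map]
lemma qsym2_map (h : Matrix (Fin 2) (Fin 2) R) (i j) :
    f (qsym2 h i j) = qsym2 (h.map f) i j := by
  fin_cases i <;> fin_cases j <;> simp [qsym2, map_ofNat]
lemma qsym3_map (h : Matrix (Fin 2) (Fin 2) R) (i j) :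
    f (qsym3 h i j) = qsym3 (h.map f) i j := by
  fin_cases i <;> fin_cases j <;> simp [qsym3, map_ofNat]
lemma qZ_map (p) : f (qZ x p) = qZ (fun p => f (x p)) p := by
  have : (qF x).map f = qF (fun p => f (x p)) := by
    ext i j; simp [qF_map]
  simp [qZ, qR, qA, qsym3_map, this]
lemma qZ_map' : (fun p => f (qZ x p)) = qZ (fun p => f (x p)) := funext (qZ_map f x)
lemma qn_map (k) : f (qn x k) = qn (fun p => f (x p)) k := by
  fin_cases k <;> simp [qn, qker_map, qgram_map, qm_map, qZ_map']
lemma qd_map (k) : f (qd x k) = qd (fun p => f (x p)) k := by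
  fin_cases k <;> simp [qd, qker_map, qm_map, qZ_map']
end nat

/-! equivariance -/
lemma qgram_symm (x : Fin 3 × Fin 4 → R) (j k) : qgram x j k = qgram x k j := by
  simp only [qgram]; ring

lemma qgram_ker (x : Fin 3 × Fin 4 → R) (j) :
    qgram x j 0 * qker x 0 + qgram x j 1 * qker x 1 + qgram x j 2 * qker x 2
      + qgram x j 3 * qker x 3 = 0 := by
  simp [qgram, qker, qdet]; ring

lemma qgram_A (S) (x : Fin 3 × Fin 4 → R) (j k) :
    qgram (qA S x) j k = ∑ a, ∑ b, S j a * S k b * qgram x a b := by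
  simp only [qgram, qA, Fin.sum_univ_four]; ring

def qdet4 (S : Fin 4 → Fin 4 → R) : R := Matrix.det (Matrix.of S)

lemma qker_A (S) (x : Fin 3 × Fin 4 → R) (k) :
    ∑ j, qker (qA S x) j * S j k = qdet4 S * qker x k := by
  fin_cases k <;>
  · simp [qker, qdet, qA, qdet4, Matrix.det_succ_row_zero, Fin.sum_univ_succ, Fin.succAbove]
    ring

lemma qdet4_sym3 (h : Matrix (Fin 2) (Fin 2) R) : qdet4 (qsym3 h) = qdt h ^ 6 := by
  simp [qsym3, qdt, qdet4, Matrix.det_succ_row_zero, Fin.sum_univ_succ, Fin.succAbove]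
  ring

lemma qm_R (h : Matrix (Fin 2) (Fin 2) R) (x : Fin 3 × Fin 4 → R) :
    qm (qR h x) 2 = qdt h ^ 2 * (qm x 2 * h 0 0 ^ 2 + qm x 1 * h 0 0 * h 1 0 + qm x 0 * h 1 0 ^ 2) ∧
    qm (qR h x) 1 = qdt h ^ 2 * (2 * qm x 2 * h 0 0 * h 0 1
      + qm x 1 * (h 0 0 * h 1 1 + h 0 1 * h 1 0) + 2 * qm x 0 * h 1 0 * h 1 1) ∧
    qm (qR h x) 0 = qdt h ^ 2 * (qm x 2 * h 0 1 ^ 2 + qm x 1 * h 0 1 * h 1 1 + qm x 0 * h 1 1 ^ 2) := by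
  have h10 := qgram_symm x 1 0
  have h20 := qgram_symm x 2 0
  have h30 := qgram_symm x 3 0
  have h21 := qgram_symm x 2 1
  have h31 := qgram_symm x 3 1
  have h32 := qgram_symm x 3 2
  refine ⟨?_, ?_, ?_⟩ <;>
  · simp only [qm, qR, qgram_A, Fin.sum_univ_four, Matrix.cons_val]
    simp only [h10, h20, h30, h21, h31, h32, qsym3, qdt, Matrix.cons_val]
    ring

lemma ql_R (h : Matrix (Fin 2) (Fin 2) R) (x : Fin 3 × Fin 4 → R) :
    h 0 0 * ql (qR h x) 0 + h 0 1 * ql (qR h x) 1 = qdt h ^ 8 * ql x 0 ∧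
    h 1 0 * ql (qR h x) 0 + h 1 1 * ql (qR h x) 1 = qdt h ^ 8 * ql x 1 := by
  obtain ⟨m2, m1, m0⟩ := qm_R h x
  have k (j) := qker_A (qsym3 h) x j
  simp only [qdet4_sym3, Fin.sum_univ_four, ← qR.eq_1] at k
  have k0 := k 0
  have k1 := k 1
  have k2 := k 2
  have k3 := k 3
  simp only [qsym3, Matrix.cons_val] at k0 k1 k2 k3
  simp only [ql, m2, m1, m0, Matrix.cons_val]
  constructor
  · linear_combination qdt h ^ 2 * (qm x 2 * k3 + qm x 1 * k2 + qm x 0 * k1)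
  · linear_combination qdt h ^ 2 * (qm x 2 * k2 + qm x 1 * k1 + qm x 0 * k0)

lemma qp_R (h : Matrix (Fin 2) (Fin 2) R) (x : Fin 3 × Fin 4 → R) :
    h 0 0 * qp (qR h x) 0 + h 0 1 * qp (qR h x) 1 = qdt h ^ 11 * qp x 0 ∧
    h 1 0 * qp (qR h x) 0 + h 1 1 * qp (qR h x) 1 = qdt h ^ 11 * qp x 1 := by
  obtain ⟨m2, m1, m0⟩ := qm_R h x
  obtain ⟨l0, l1⟩ := ql_R h x
  simp only [qp, m2, m1, m0, Matrix.cons_val]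
  constructor
  · have e : qdt h = h 0 0 * h 1 1 - h 0 1 * h 1 0 := rfl
    linear_combination -qdt h ^ 3 * (qm x 1 * l0 + 2 * qm x 0 * l1) + (-qdt h ^ 2 * (qm x 1 * (h 0 0 * ql (qR h x) 0 + h 0 1 * ql (qR h x) 1) + 2 * qm x 0 * (h 1 0 * ql (qR h x) 0 + h 1 1 * ql (qR h x) 1))) * (-e)
  · have e : qdt h = h 0 0 * h 1 1 - h 0 1 * h 1 0 := rfl
    linear_combination qdt h ^ 3 * (2 * qm x 2 * l0 + qm x 1 * l1) + (qdt h ^ 2 * (2 * qm x 2 * (h 0 0 * ql (qR h x) 0 + h 0 1 * ql (qR h x) 1) + qm x 1 * (h 1 0 * ql (qR h x) 0 + h 1 1 * ql (qR h x) 1))) * (-e)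

lemma qsym3_mul (h k : Matrix (Fin 2) (Fin 2) R) (i j) :
    qsym3 (h * k) i j = ∑ l, qsym3 k i l * qsym3 h l j := by
  fin_cases i <;> fin_cases j <;>
  · simp [qsym3, Matrix.mul_apply, Fin.sum_univ_succ]; ring

lemma qR_R (h k : Matrix (Fin 2) (Fin 2) R) (x : Fin 3 × Fin 4 → R) :
    qR k (qR h x) = qR (h * k) x := by
  ext p
  simp only [qR, qA, qsym3_mul, Fin.sum_univ_four]; ring

lemma qL_R (g h : Matrix (Fin 2) (Fin 2) R) (x : Fin 3 × Fin 4 → R) :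
    qR h (qL g x) = qL g (qR h x) := by
  ext p
  simp only [qR, qA, qL, Fin.sum_univ_four, Fin.sum_univ_three]; ring

lemma qR_one (x : Fin 3 × Fin 4 → R) : qR 1 x = x := by
  ext ⟨i, j⟩
  fin_cases j <;> simp [qR, qA, qsym3, Fin.sum_univ_four]

lemma qF_R (h : Matrix (Fin 2) (Fin 2) R) (hd : qdt h = 1) (x : Fin 3 × Fin 4 → R) :
    h * qF (qR h x) = qF x := by
  obtain ⟨l0, l1⟩ := ql_R h x
  obtain ⟨p0, p1⟩ := qp_R h x
  rw [hd] at *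
  ext i j
  fin_cases i <;> fin_cases j <;> simp [qF, Matrix.mul_apply] <;> simp_all

lemma qZ_R (h : Matrix (Fin 2) (Fin 2) R) (hd : qdt h = 1) (x : Fin 3 × Fin 4 → R) :
    qZ (qR h x) = qZ x := by
  rw [qZ, qR_R, qF_R h hd, qZ]

lemma qgram_L (g : Matrix (Fin 2) (Fin 2) R) (x : Fin 3 × Fin 4 → R) (j k) :
    qgram (qL g x) j k = qdt g ^ 2 * qgram x j k := by
  simp [qgram, qL, Fin.sum_univ_three, qsym2, qdt]; ring

lemma qdet_L (g : Matrix (Fin 2) (Fin 2) R) (x : Fin 3 × Fin 4 → R) (j k l) :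
    qdet (qL g x) j k l = qdt g ^ 3 * qdet x j k l := by
  simp [qdet, qL, Fin.sum_univ_three, qsym2, qdt]; ring

lemma qker_L (g : Matrix (Fin 2) (Fin 2) R) (x : Fin 3 × Fin 4 → R) (j) :
    qker (qL g x) j = qdt g ^ 3 * qker x j := by
  fin_cases j <;> simp [qker, qdet_L]

lemma qm_L (g : Matrix (Fin 2) (Fin 2) R) (hg : qdt g = 1) (x : Fin 3 × Fin 4 → R) :
    qm (qL g x) = qm x := by
  simp [qm, qgram_L, hg]

lemma qZ_L (g : Matrix (Fin 2) (Fin 2) R) (hg : qdt g = 1) (x : Fin 3 × Fin 4 → R) :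
    qZ (qL g x) = qL g (qZ x) := by
  have : qF (qL g x) = qF x := by simp [qF, ql, qp, qm_L g hg, qker_L, hg]
  rw [qZ, this, qL_R, qZ]

lemma qn_LR (g h : Matrix (Fin 2) (Fin 2) R) (hg : qdt g = 1) (hh : qdt h = 1)
    (x : Fin 3 × Fin 4 → R) : qn (qL g (qR h x)) = qn x ∧ qd (qL g (qR h x)) = qd x := by
  simp [qn, qd, qZ_L g hg, qZ_R h hh, qm_L g hg, qker_L, qgram_L, hg]

lemma qgram_s (s : Fin 4 → R) (x : Fin 3 × Fin 4 → R) (j k) :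
    qgram (fun p => s p.2 * x p) j k = s j * s k * qgram x j k := by
  simp [qgram]; ring
lemma qdet_s (s : Fin 4 → R) (x : Fin 3 × Fin 4 → R) (j k l) :
    qdet (fun p => s p.2 * x p) j k l = s j * s k * s l * qdet x j k l := by
  simp [qdet]; ring

lemma qZ_t (t : R) (x : Fin 3 × Fin 4 → R) :
    qZ (fun p => t * x p) = fun p => (![t ^ 22, t ^ 20, t ^ 18, t ^ 16] : Fin 4 → R) p.2 * qZ x p := by
  have hg (j k) := qgram_s (fun _ => t) x j k
  have hd (j k l) := qdet_s (fun _ => t) x j k l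
  have hk (j) : qker (fun p => t * x p) j = t ^ 3 * qker x j := by
    fin_cases j <;> simp [qker, hd] <;> ring
  have hm (j) : qm (fun p => t * x p) j = t ^ 2 * qm x j := by
    fin_cases j <;> simp [qm, hg] <;> ring
  have hl (j) : ql (fun p => t * x p) j = t ^ 5 * ql x j := by
    fin_cases j <;> simp [ql, hm, hk] <;> ring
  have hp (j) : qp (fun p => t * x p) j = t ^ 7 * qp x j := by
    fin_cases j <;> simp [qp, hm, hl] <;> ring
  ext ⟨i, j⟩
  fin_cases j <;> simp [qZ, qR, qA, Fin.sum_univ_four, qsym3, qF, hl, hp] <;> ring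

lemma qnd_t (t : R) (x : Fin 3 × Fin 4 → R) (k) : qn (fun p => t * x p) k * qd x k
    = qd (fun p => t * x p) k * qn x k := by
  fin_cases k <;> simp [qn, qd, qZ_t, qker, qdet_s, qm, qgram_s] <;> ring

lemma qnd_inv (g h : Matrix (Fin 2) (Fin 2) R) (hg : qdt g = 1) (hh : qdt h = 1) (t : R)
    (x : Fin 3 × Fin 4 → R) (k) : qn (fun p => t * qL g (qR h x) p) k * qd x k
    = qd (fun p => t * qL g (qR h x) p) k * qn x k := by
  rw [← (qn_LR g h hg hh x).1, ← (qn_LR g h hg hh x).2]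
  exact qnd_t t _ k
end helpers
section sep

def qNf {R : Type*} [CommRing R] (T : Fin 5 → R) : Fin 4 → Fin 4 → R :=
  let n11 := 3 * T 3 - 1
  let n03 := -(T 1 * (-T 4) + T 2 * T 0 + T 3)
  let n12 := 9 * n03
  let n13 := -(T 2 * (-T 4) + n11 * T 0 + n12)
  let n22 := 3 * n13 - T 4
  let n23 := -(T 3 * (-T 4) + n12 * T 0 + n22)
  let n33 := -(n03 * (-T 4) + n13 * T 0 + n23)
  ![![T 1, T 2, T 3, n03], ![T 2, n11, n12, n13], ![T 3, n12, n22, n23], ![n03, n13, n23, n33]]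

lemma qNf_unique {K : Type*} [Field K] (T : Fin 5 → K) (N : Fin 4 → Fin 4 → K)
    (hs : ∀ j k, N j k = N k j)
    (hk : ∀ j, N j 0 * (-T 4) + N j 1 * T 0 + N j 2 + N j 3 = 0)
    (h00 : N 0 0 = T 1) (h01 : N 0 1 = T 2) (h02 : N 0 2 = T 3)
    (m0 : 3 * N 0 2 - N 1 1 = 1) (m1 : 9 * N 0 3 - N 1 2 = 0) (m2 : 3 * N 1 3 - N 2 2 = T 4) :
    N = qNf T := by
  have a11 : N 1 1 = 3 * T 3 - 1 := by linear_combination 3 * h02 - m0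
  have a03 : N 0 3 = -(T 1 * (-T 4) + T 2 * T 0 + T 3) := by
    rw [← h00, ← h01, ← h02]; linear_combination hk 0
  have a12 : N 1 2 = 9 * N 0 3 := by linear_combination -m1
  have a13 : N 1 3 = -(T 2 * (-T 4) + N 1 1 * T 0 + N 1 2) := by
    have := hk 1
    rw [hs 1 0, h01] at this
    linear_combination this
  have a22 : N 2 2 = 3 * N 1 3 - T 4 := by linear_combination -m2
  have a23 : N 2 3 = -(T 3 * (-T 4) + N 1 2 * T 0 + N 2 2) := by
    have := hk 2
    rw [hs 2 0, h02, hs 2 1] at this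
    linear_combination this
  have a33 : N 3 3 = -(N 0 3 * (-T 4) + N 1 3 * T 0 + N 2 3) := by
    have := hk 3
    rw [hs 3 0, hs 3 1, hs 3 2] at this
    linear_combination this
  have b (j k) := hs j k
  funext j k
  fin_cases j <;> fin_cases k <;> simp only [qNf, Fin.zero_eta, Fin.mk_one, Fin.reduceFinMk, Matrix.cons_val]
  · exact h00
  · exact h01
  · exact h02
  · exact a03
  · rw [hs]; exact h01
  · exact a11
  · rw [a12, a03]
  · rw [a13, a12, a03, a11]
  · rw [hs]; exact h02
  · rw [hs, a12, a03]
  · rw [a22, a13, a12, a03, a11]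
  · rw [a23, a22, a13, a12, a03, a11]
  · rw [hs]; exact a03
  · rw [hs, a13, a12, a03, a11]
  · rw [hs, a23, a22, a13, a12, a03, a11]
  · rw [a33, a23, a22, a13, a12, a03, a11]

variable {K : Type*} [Field K]

lemma q_normal (x : Fin 3 × Fin 4 → K) (hF : qdt (qF x) ≠ 0) :
    qm (qZ x) 1 = 0 ∧ qm (qZ x) 2 * qker (qZ x) 2 + qm (qZ x) 0 * qker (qZ x) 0 = 0 := by
  obtain ⟨l0, l1⟩ := ql_R (qF x) x
  obtain ⟨p0, p1⟩ := qp_R (qF x) x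
  rw [← qZ] at l0 l1 p0 p1
  have e00 : qF x 0 0 = ql x 0 := rfl
  have e10 : qF x 1 0 = ql x 1 := rfl
  have e01 : qF x 0 1 = qp x 0 := rfl
  have e11 : qF x 1 1 = qp x 1 := rfl
  have eD : qdt (qF x) = qF x 0 0 * qF x 1 1 - qF x 0 1 * qF x 1 0 := rfl
  have L1 : ql (qZ x) 1 = 0 := by
    apply (mul_right_inj' hF).1
    rw [← e00] at l0; rw [← e10] at l1
    linear_combination qF x 0 0 * l1 - qF x 1 0 * l0 + ql (qZ x) 1 * eD
  have L0 : ql (qZ x) 0 = qdt (qF x) ^ 8 := by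
    apply (mul_right_inj' hF).1
    rw [← e00] at l0; rw [← e10] at l1
    linear_combination qF x 1 1 * l0 - qF x 0 1 * l1 + (ql (qZ x) 0 - qdt (qF x) ^ 8) * eD
  have P0 : qp (qZ x) 0 = 0 := by
    apply (mul_right_inj' hF).1
    rw [← e01] at p0; rw [← e11] at p1
    linear_combination qF x 1 1 * p0 - qF x 0 1 * p1 + qp (qZ x) 0 * eD
  have hm : qm (qZ x) 1 = 0 := by
    have : qp (qZ x) 0 = -(qm (qZ x) 1 * ql (qZ x) 0 + 2 * qm (qZ x) 0 * ql (qZ x) 1) := rfl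
    rw [P0, L1, L0] at this
    have h8 : qdt (qF x) ^ 8 ≠ 0 := pow_ne_zero _ hF
    apply (mul_left_inj' h8).1
    linear_combination this
  refine ⟨hm, ?_⟩
  have : ql (qZ x) 1 = qm (qZ x) 2 * qker (qZ x) 2 + qm (qZ x) 1 * qker (qZ x) 1
    + qm (qZ x) 0 * qker (qZ x) 0 := rfl
  rw [L1, hm] at this
  linear_combination -this

lemma qR_diag (a b : K) (x : Fin 3 × Fin 4 → K) :
    qR !![a, 0; 0, b] x = fun p => (![b ^ 3, a * b ^ 2, a ^ 2 * b, a ^ 3] : Fin 4 → K) p.2 * x p := by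
  ext ⟨i, j⟩
  fin_cases j <;> simp [qR, qA, qsym3, Fin.sum_univ_four]

lemma q_toNormal (x : Fin 3 × Fin 4 → K) (hF : qdt (qF x) ≠ 0) (h2 : qker (qZ x) 2 ≠ 0)
    (h3 : qker (qZ x) 3 ≠ 0) (h0 : qm (qZ x) 0 ≠ 0) :
    ∃ (h : Matrix (Fin 2) (Fin 2) K) (κ : K), h.det ≠ 0 ∧ κ ≠ 0 ∧ qker (qR h x) 3 ≠ 0 ∧
      ∀ j k, qgram (qR h x) j k = κ * qNf (fun k => qn x k / qd x k) j k := by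
  obtain ⟨m1, m2⟩ := q_normal x hF
  set z := qZ x with hz
  set T := fun k => qn x k / qd x k with hT
  have T0 : T 0 = qker z 1 * qker z 3 / qker z 2 ^ 2 := rfl
  have T1 : T 1 = qgram z 0 0 * qker z 2 ^ 2 / (qm z 0 * qker z 3 ^ 2) := rfl
  have T2 : T 2 = qgram z 0 1 * qker z 2 / (qm z 0 * qker z 3) := rfl
  have T3 : T 3 = qgram z 0 2 / qm z 0 := rfl
  have T4 : T 4 = qm z 2 * qker z 3 ^ 2 / (qm z 0 * qker z 2 ^ 2) := rfl
  have T4' : - T 4 = qker z 0 * qker z 3 ^ 2 / qker z 2 ^ 3 := by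
    rw [T4]; field_simp; linear_combination -m2
  set w := qR !![qker z 3, 0; 0, qker z 2] z with hw
  have gw (j k) : qgram w j k = (![qker z 2 ^ 3, qker z 3 * qker z 2 ^ 2, qker z 3 ^ 2 * qker z 2, qker z 3 ^ 3] : Fin 4 → K) j * (![qker z 2 ^ 3, qker z 3 * qker z 2 ^ 2, qker z 3 ^ 2 * qker z 2, qker z 3 ^ 3] : Fin 4 → K) k * qgram z j k := by
    rw [hw, qR_diag, qgram_s]
  set κ := qm z 0 * qker z 3 ^ 2 * qker z 2 ^ 4 with hκ
  have κ0 : κ ≠ 0 := by positivity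
  have e0 : 3 * qgram z 0 2 - qgram z 1 1 = qm z 0 := rfl
  have e1 : 9 * qgram z 0 3 - qgram z 1 2 = qm z 1 := rfl
  have e2 : 3 * qgram z 1 3 - qgram z 2 2 = qm z 2 := rfl
  have key : (fun j k => qgram w j k / κ) = qNf T := by
    apply qNf_unique
    · intro j k; rw [qgram_symm]
    · intro j
      have := qgram_ker z j
      rw [T4', T0]
      simp only [gw]
      fin_cases j <;> simp only [Fin.zero_eta, Fin.mk_one, Fin.reduceFinMk, Matrix.cons_val] at this ⊢ <;> field_simp
      · linear_combination qker z 2 ^ 3 * qker z 3 ^ 2 * this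
      · linear_combination qker z 3 ^ 3 * qker z 2 ^ 2 * this
      · linear_combination qker z 3 ^ 4 * qker z 2 * this
      · linear_combination qker z 3 ^ 5 * this
    · rw [T1]; simp only [gw, hκ, Matrix.cons_val]; field_simp
    · rw [T2]; simp only [gw, hκ, Matrix.cons_val]; field_simp
    · rw [T3]; simp only [gw, hκ, Matrix.cons_val]; field_simp
    · simp only [gw, hκ, Matrix.cons_val]; field_simp; linear_combination e0
    · simp only [gw, hκ, Matrix.cons_val]; field_simp; linear_combination qker z 3 * e1 + qker z 3 * m1
    · rw [T4]; simp only [gw, hκ, Matrix.cons_val]; field_simp; linear_combination e2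
  have hh : qR (qF x * !![qker z 3, 0; 0, qker z 2]) x = w := by
    rw [hw, hz, ← qR_R, ← qZ]
  refine ⟨qF x * !![qker z 3, 0; 0, qker z 2], κ, ?_, κ0, ?_, ?_⟩
  · have : (qF x).det ≠ 0 := by rwa [Matrix.det_fin_two]
    simp [Matrix.det_fin_two_of, this, h2, h3]
  · rw [hh, hw, qR_diag]
    simp only [qker, Matrix.cons_val, qdet_s]
    have : qdet z 0 1 2 ≠ 0 := h3
    positivity
  · intro j k
    rw [hh, ← key]; field_simp

lemma qsym2_of_orth [IsAlgClosed K] [CharZero K] (A : Fin 3 → Fin 3 → K)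
    (h : ∀ i j, A 1 i * A 1 j - 2 * (A 2 i * A 0 j + A 0 i * A 2 j) =
      (!![0, 0, -2; 0, 1, 0; -2, 0, 0] : Matrix (Fin 3) (Fin 3) K) i j) :
    ∃ (g : Matrix (Fin 2) (Fin 2) K) (ε : K), ∀ i j, A i j = ε * qsym2 g i j := by
  have sq (u w z : K) (huz : w ^ 2 - 4 * u * z = 0) :
      ∃ d c : K, u = d ^ 2 ∧ z = c ^ 2 ∧ w = 2 * c * d := by
    obtain ⟨d, hd⟩ := IsAlgClosed.exists_pow_nat_eq u (n := 2) (by norm_num)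
    obtain ⟨c, hc⟩ := IsAlgClosed.exists_pow_nat_eq z (n := 2) (by norm_num)
    have : (w - 2 * c * d) * (w + 2 * c * d) = 0 := by
      rw [← hd, ← hc] at huz; linear_combination huz
    rcases mul_eq_zero.1 this with h | h
    · exact ⟨d, c, hd.symm, hc.symm, by linear_combination h⟩
    · exact ⟨d, -c, hd.symm, by rw [← hc]; ring, by linear_combination h⟩
  have h00 := h 0 0
  have h22 := h 2 2
  have h02 := h 0 2
  have h01 := h 0 1
  have h12 := h 1 2
  have h11 := h 1 1
  simp at h00 h22 h02 h01 h12 h11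
  obtain ⟨d, c, u0, z0, w0⟩ := sq (A 0 0) (A 1 0) (A 2 0) (by linear_combination h00)
  obtain ⟨b, a, u2, z2, w2⟩ := sq (A 0 2) (A 1 2) (A 2 2) (by linear_combination h22)
  rw [u0, z0, w0, u2, z2, w2] at h02
  rw [u0, z0, w0] at h01
  rw [u2, z2, w2] at h12
  have hd : (a * d - b * c) ^ 2 = 1 := by
    have h2 : (2 : K) ≠ 0 := two_ne_zero
    apply (mul_right_inj' h2).1
    linear_combination -h02
  obtain ⟨a, b, hdet, u2, z2, w2, h12⟩ : ∃ a b : K, a * d - b * c = 1 ∧ A 0 2 = b ^ 2 ∧ A 2 2 = a ^ 2 ∧ A 1 2 = 2 * a * b ∧ A 1 1 * (2 * a * b) - 2 * (A 2 1 * b ^ 2 + A 0 1 * a ^ 2) = 0 := by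
    rcases mul_self_eq_one_iff.1 ((pow_two _).symm.trans hd) with h | h
    · exact ⟨a, b, h, u2, z2, w2, h12⟩
    · exact ⟨-a, -b, by linear_combination -h, by rw [u2]; ring, by rw [z2]; ring, by rw [w2]; ring, by linear_combination h12⟩
  have e1 : a ^ 2 * A 0 1 - a * b * A 1 1 + b ^ 2 * A 2 1 = 0 := by
    have h2 : (2 : K) ≠ 0 := two_ne_zero
    apply (mul_right_inj' h2).1
    linear_combination -h12
  have e2 : c ^ 2 * A 0 1 - c * d * A 1 1 + d ^ 2 * A 2 1 = 0 := by
    have h2 : (2 : K) ≠ 0 := two_ne_zero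
    apply (mul_right_inj' h2).1
    linear_combination -h01
  obtain ⟨β, hβ⟩ : ∃ β, β = (a * d + b * c) * A 1 1 - 2 * (a * c * A 0 1 + b * d * A 2 1) := ⟨_, rfl⟩
  have f0 : A 0 1 = β * (b * d) := by
    have : A 0 1 * (a * d - b * c) ^ 2 = β * (b * d) := by
      rw [hβ]; linear_combination d ^ 2 * e1 + b ^ 2 * e2
    rwa [hdet, one_pow, mul_one] at this
  have f1 : A 1 1 = β * (a * d + b * c) := by
    have : A 1 1 * (a * d - b * c) ^ 2 = β * (a * d + b * c) := by
      rw [hβ]; linear_combination 2 * c * d * e1 + 2 * a * b * e2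
    rwa [hdet, one_pow, mul_one] at this
  have f2 : A 2 1 = β * (a * c) := by
    have : A 2 1 * (a * d - b * c) ^ 2 = β * (a * c) := by
      rw [hβ]; linear_combination c ^ 2 * e1 + a ^ 2 * e2
    rwa [hdet, one_pow, mul_one] at this
  have hβ2 : β ^ 2 = 1 := by
    have : β ^ 2 * (a * d - b * c) ^ 2 = 1 := by
      rw [f0, f1, f2] at h11; linear_combination h11
    rwa [hdet, one_pow, mul_one] at this
  rcases mul_self_eq_one_iff.1 ((pow_two _).symm.trans hβ2) with h | h
  · refine ⟨!![a, b; c, d], 1, fun i j => ?_⟩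
    rw [h] at f0 f1 f2
    fin_cases i <;> fin_cases j <;> simp [qsym2] <;> simp_all
  · obtain ⟨I, hI⟩ := IsAlgClosed.exists_pow_nat_eq (-1 : K) (n := 2) (by norm_num)
    refine ⟨!![I * a, I * b; -(I * c), -(I * d)], -1, fun i j => ?_⟩
    rw [h] at f0 f1 f2
    fin_cases i <;> fin_cases j <;> simp [qsym2, u0, z0, w0, u2, z2, w2, f0, f1, f2]
    · linear_combination d ^ 2 * hI
    · linear_combination -(b * d) * hI
    · linear_combination b ^ 2 * hI
    · linear_combination 2 * c * d * hI
    · linear_combination -(b * c + a * d) * hI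
    · linear_combination 2 * a * b * hI
    · linear_combination c ^ 2 * hI
    · linear_combination -(a * c) * hI
    · linear_combination a ^ 2 * hI

lemma q_witt [IsAlgClosed K] [CharZero K] (x y : Fin 3 × Fin 4 → K) (hx : qker x 3 ≠ 0)
    (h : ∀ j k, qgram x j k = qgram y j k) :
    ∃ (g : Matrix (Fin 2) (Fin 2) K) (ε : K), y = fun p => ε * qL g x p := by
  let J : Matrix (Fin 3) (Fin 3) K := !![0, 0, -2; 0, 1, 0; -2, 0, 0]
  let X : Matrix (Fin 3) (Fin 3) K := Matrix.of fun i j => x (i, j.castSucc)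
  let Y : Matrix (Fin 3) (Fin 3) K := Matrix.of fun i j => y (i, j.castSucc)
  have hXd : X.det = qker x 3 := by
    simp [X, Matrix.det_fin_three, qker, qdet]; ring
  have hXu : IsUnit X.det := by rw [hXd]; exact hx.isUnit
  have gr (u w : Fin 3 → K) : u ⬝ᵥ (J.mulVec w) = u 1 * w 1 - 2 * (u 2 * w 0 + u 0 * w 2) := by
    simp [J, dotProduct, Matrix.mulVec, Fin.sum_univ_three]; ring
  have hG : X.transpose * J * X = Y.transpose * J * Y := by
    ext i j
    have e (Z : Matrix (Fin 3) (Fin 3) K) : (Z.transpose * J * Z) i j =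
        (fun a => Z a i) ⬝ᵥ (J.mulVec fun a => Z a j) := by
      rw [Matrix.mul_assoc, Matrix.mul_apply]; rfl
    rw [e, e, gr, gr]
    exact h i.castSucc j.castSucc
  obtain ⟨A, hAX⟩ : ∃ A : Matrix (Fin 3) (Fin 3) K, A * X = Y :=
    ⟨Y * X⁻¹, by simp [Matrix.mul_assoc, Matrix.nonsing_inv_mul X hXu]⟩
  have hXt : IsUnit X.transpose.det := by rwa [Matrix.det_transpose]
  have hA : A.transpose * J * A = J := by
    have : X.transpose * (A.transpose * J * A) * X = X.transpose * J * X := by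
      rw [hG, ← hAX, Matrix.transpose_mul]; simp only [Matrix.mul_assoc]
    have h1 := congrArg (fun M => X.transpose⁻¹ * M * X⁻¹) this
    simpa [Matrix.mul_assoc, Matrix.mul_nonsing_inv X hXu, Matrix.nonsing_inv_mul_cancel_left _ _ hXt] using h1
  have hAe : ∀ i j, A 1 i * A 1 j - 2 * (A 2 i * A 0 j + A 0 i * A 2 j) = J i j := by
    intro i j
    rw [← gr (fun a => A a i) (fun a => A a j)]
    conv_rhs => rw [← hA, Matrix.mul_assoc, Matrix.mul_apply]
    rfl
  have hJ : IsUnit (A.transpose * J).det := by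
    have : (A.transpose * J).det * A.det = J.det := by rw [← Matrix.det_mul, hA]
    have hJd : J.det = -4 := by simp [J, Matrix.det_fin_three]; norm_num
    rw [hJd] at this
    refine IsUnit.mk0 _ fun h => ?_
    rw [h, zero_mul] at this
    norm_num at this
  have h3 : A.mulVec (fun i => x (i, 3)) = fun i => y (i, 3) := by
    have h1 : (X.transpose * (A.transpose * J)).mulVec (A.mulVec (fun i => x (i, 3))) =
        (X.transpose * (A.transpose * J)).mulVec (fun i => y (i, 3)) := by
      rw [Matrix.mulVec_mulVec, Matrix.mul_assoc, hA, ← Matrix.mul_assoc, ← Matrix.transpose_mul, hAX]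
      ext j
      rw [← Matrix.mulVec_mulVec, ← Matrix.mulVec_mulVec]
      change (fun a => X a j) ⬝ᵥ _ = (fun a => Y a j) ⬝ᵥ _
      rw [gr, gr]
      exact h j.castSucc 3
    have hu : IsUnit (X.transpose * (A.transpose * J)).det := by
      rw [Matrix.det_mul]; exact hXt.mul hJ
    have h2 := congrArg (fun w => (X.transpose * (A.transpose * J))⁻¹.mulVec w) h1
    beta_reduce at h2
    rwa [Matrix.mulVec_mulVec, Matrix.nonsing_inv_mul _ hu, Matrix.one_mulVec,
      Matrix.mulVec_mulVec, Matrix.nonsing_inv_mul _ hu, Matrix.one_mulVec] at h2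
  obtain ⟨g, ε, hg⟩ := qsym2_of_orth A hAe
  refine ⟨g, ε, ?_⟩
  ext ⟨i, j⟩
  have e : ε * qL g x (i, j) = ∑ a, A i a * x (a, j) := by
    simp only [qL, hg, Finset.mul_sum, mul_assoc]
  rw [e]
  induction j using Fin.lastCases with
  | last => exact (congrFun h3 i).symm
  | cast j => exact (congrFun (congrFun hAX i) j).symm

lemma q_sep [IsAlgClosed K] [CharZero K] (x y : Fin 3 × Fin 4 → K)
    (hxF : qdt (qF x) ≠ 0) (hx2 : qker (qZ x) 2 ≠ 0)
    (hx3 : qker (qZ x) 3 ≠ 0) (hx0 : qm (qZ x) 0 ≠ 0)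
    (hyF : qdt (qF y) ≠ 0) (hy2 : qker (qZ y) 2 ≠ 0)
    (hy3 : qker (qZ y) 3 ≠ 0) (hy0 : qm (qZ y) 0 ≠ 0)
    (hI : ∀ k, qn x k / qd x k = qn y k / qd y k) :
    ∃ (g h : Matrix (Fin 2) (Fin 2) K) (t : K), y = fun p => t * qL g (qR h x) p := by
  obtain ⟨h, κ, hh, hκ, hk, hN⟩ := q_toNormal x hxF hx2 hx3 hx0
  obtain ⟨h', κ', hh', hκ', hk', hN'⟩ := q_toNormal y hyF hy2 hy3 hy0
  obtain ⟨s, hs⟩ := IsAlgClosed.exists_pow_nat_eq (κ' / κ) (n := 2) (by norm_num)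
  have s0 : s ≠ 0 := by
    rintro rfl
    have : κ' / κ ≠ 0 := div_ne_zero hκ' hκ
    exact this (by rw [← hs]; simp)
  obtain ⟨g, ε, hg⟩ := q_witt (fun p => s * qR h x p) (qR h' y) (by
      simp only [qker, Matrix.cons_val] at hk ⊢
      rw [qdet_s (fun _ => s)]
      positivity) (fun j k => by
      rw [qgram_s (fun _ => s), hN, hN']
      simp only [← pow_two, hs, hI]
      field_simp)
  refine ⟨g, h * h'⁻¹, ε * s, ?_⟩
  have hu : IsUnit h'.det := hh'.isUnit
  have e1 : y = qR h'⁻¹ (qR h' y) := by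
    rw [qR_R, Matrix.mul_nonsing_inv _ hu, qR_one]
  rw [e1, hg, ← qR_R, ← qL_R]
  ext p
  simp only [qL, qR, qA, Finset.mul_sum]
  simp only [Fin.sum_univ_three, Fin.sum_univ_four]
  ring
end sep
section dom

def qD {R : Type*} [CommRing R] (T : Fin 5 → R) : R :=
  qNf T 1 1 * (qNf T 0 1 ^ 2 - qNf T 0 0 * qNf T 1 1) * T 4 * (T 0 + T 4) *
  (qNf T 0 0 * (qNf T 1 1 * qNf T 2 2 - qNf T 1 2 * qNf T 1 2)
    - qNf T 0 1 * (qNf T 0 1 * qNf T 2 2 - qNf T 1 2 * qNf T 0 2)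
    + qNf T 0 2 * (qNf T 0 1 * qNf T 1 2 - qNf T 1 1 * qNf T 0 2))

lemma q_chol (n00 n01 n02 n11 n12 n22 : ℂ) (h1 : n11 ≠ 0) (h2 : n01 ^ 2 - n00 * n11 ≠ 0) :
    ∃ w : Fin 3 → Fin 3 → ℂ,
      (w 1 0 * w 1 0 - 2 * (w 2 0 * w 0 0 + w 0 0 * w 2 0) = n00) ∧
      (w 1 0 * w 1 1 - 2 * (w 2 0 * w 0 1 + w 0 0 * w 2 1) = n01) ∧
      (w 1 0 * w 1 2 - 2 * (w 2 0 * w 0 2 + w 0 0 * w 2 2) = n02) ∧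
      (w 1 1 * w 1 1 - 2 * (w 2 1 * w 0 1 + w 0 1 * w 2 1) = n11) ∧
      (w 1 1 * w 1 2 - 2 * (w 2 1 * w 0 2 + w 0 1 * w 2 2) = n12) ∧
      (w 1 2 * w 1 2 - 2 * (w 2 2 * w 0 2 + w 0 2 * w 2 2) = n22) := by
  obtain ⟨b, hb⟩ := IsAlgClosed.exists_pow_nat_eq n11 (n := 2) (by norm_num)
  have b0 : b ≠ 0 := by rintro rfl; apply h1; rw [← hb]; simp
  obtain ⟨a, ha⟩ : ∃ a : ℂ, (n01 ^ 2 - n00 * n11) * a ^ 2 + (2 * n02 * n11 - 2 * n12 * n01) * a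
      + (n12 ^ 2 - n22 * n11) = 0 := by
    obtain ⟨s, hs⟩ := IsAlgClosed.exists_pow_nat_eq
      (discrim (n01 ^ 2 - n00 * n11) (2 * n02 * n11 - 2 * n12 * n01) (n12 ^ 2 - n22 * n11))
      (n := 2) (by norm_num)
    obtain ⟨a, ha⟩ := exists_quadratic_eq_zero h2 ⟨s, by rw [← hs, pow_two]⟩
    exact ⟨a, by linear_combination ha⟩
  refine ⟨![![-n00 / 4, -n01 / 2, a * n00 / 4 - n02 / 2], ![0, b, (n12 - a * n01) / b], ![1, 0, a]],
    ?_, ?_, ?_, ?_, ?_, ?_⟩ <;> simp only [Matrix.cons_val]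
  · ring
  · ring
  · ring
  · linear_combination hb
  · field_simp; ring
  · rw [← hb] at ha
    field_simp
    linear_combination 4 * ha

lemma q_dom (T : Fin 5 → ℂ) (hD : qD T ≠ 0) : ∃ x : Fin 3 × Fin 4 → ℂ, qdt (qF x) ≠ 0 ∧
    qker (qZ x) 2 ≠ 0 ∧ qker (qZ x) 3 ≠ 0 ∧ qm (qZ x) 0 ≠ 0 ∧ ∀ k, qn x k / qd x k = T k := by
  simp only [qD, mul_ne_zero_iff] at hD
  obtain ⟨⟨⟨⟨h11, h2⟩, hT4⟩, hT0⟩, hdet⟩ := hD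
  obtain ⟨w, e00, e01, e02, e11, e12, e22⟩ := q_chol (qNf T 0 0) (qNf T 0 1) (qNf T 0 2)
    (qNf T 1 1) (qNf T 1 2) (qNf T 2 2) h11 h2
  obtain ⟨x, x0, x1, x2, x3⟩ : ∃ x : Fin 3 × Fin 4 → ℂ, (∀ i, x (i, 0) = w i 0) ∧
      (∀ i, x (i, 1) = w i 1) ∧ (∀ i, x (i, 2) = w i 2) ∧
      (∀ i, x (i, 3) = -(-T 4 * w i 0 + T 0 * w i 1 + w i 2)) :=
    ⟨fun p => (![w p.1 0, w p.1 1, w p.1 2, -(-T 4 * w p.1 0 + T 0 * w p.1 1 + w p.1 2)] :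
      Fin 4 → ℂ) p.2, fun _ => rfl, fun _ => rfl, fun _ => rfl, fun _ => rfl⟩
  have g00 : qgram x 0 0 = T 1 := by simp only [qgram, x0, e00]; rfl
  have g01 : qgram x 0 1 = T 2 := by simp only [qgram, x0, x1, e01]; rfl
  have g02 : qgram x 0 2 = T 3 := by simp only [qgram, x0, x2, e02]; rfl
  have g11 : qgram x 1 1 = qNf T 1 1 := by simp only [qgram, x1, e11]
  have g12 : qgram x 1 2 = qNf T 1 2 := by simp only [qgram, x1, x2, e12]
  have g22 : qgram x 2 2 = qNf T 2 2 := by simp only [qgram, x2, e22]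
  have g03 : qgram x 0 3 = qNf T 0 3 := by
    have : qgram x 0 3 = -(-T 4 * qgram x 0 0 + T 0 * qgram x 0 1 + qgram x 0 2) := by
      simp only [qgram, x0, x1, x2, x3]; ring
    rw [this, g00, g01, g02]; simp [qNf]; ring
  have g13 : qgram x 1 3 = qNf T 1 3 := by
    have : qgram x 1 3 = -(-T 4 * qgram x 0 1 + T 0 * qgram x 1 1 + qgram x 1 2) := by
      simp only [qgram, x0, x1, x2, x3]; ring
    rw [this, g01, g11, g12]; simp [qNf]; ring
  have m0 : qm x 0 = 1 := by
    simp only [qm, Matrix.cons_val, g02, g11]; simp [qNf]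
  have m1 : qm x 1 = 0 := by
    simp only [qm, Matrix.cons_val, g03, g12]; simp [qNf]
  have m2 : qm x 2 = T 4 := by
    simp only [qm, Matrix.cons_val, g13, g22]; simp [qNf]
  obtain ⟨δ, hδ⟩ : ∃ δ, δ = qker x 3 := ⟨_, rfl⟩
  have k0 : qker x 0 = -T 4 * δ := by
    rw [hδ]; simp only [qker, Matrix.cons_val, qdet, x0, x1, x2, x3]; ring
  have k1 : qker x 1 = T 0 * δ := by
    rw [hδ]; simp only [qker, Matrix.cons_val, qdet, x0, x1, x2, x3]; ring
  have k2 : qker x 2 = δ := by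
    rw [hδ]; simp only [qker, Matrix.cons_val, qdet, x0, x1, x2, x3]; ring
  have δ0 : δ ≠ 0 := by
    intro h
    apply hdet
    have : qNf T 0 0 * (qNf T 1 1 * qNf T 2 2 - qNf T 1 2 * qNf T 1 2)
      - qNf T 0 1 * (qNf T 0 1 * qNf T 2 2 - qNf T 1 2 * qNf T 0 2)
      + qNf T 0 2 * (qNf T 0 1 * qNf T 1 2 - qNf T 1 1 * qNf T 0 2) = -4 * δ ^ 2 := by
      rw [hδ, ← e00, ← e01, ← e02, ← e11, ← e12, ← e22]
      simp only [qker, Matrix.cons_val, qdet, x0, x1, x2]; ring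
    rw [this, h]; simp
  obtain ⟨e, he⟩ : ∃ e, e = δ * (T 0 + T 4) := ⟨_, rfl⟩
  have e0 : e ≠ 0 := by rw [he]; exact mul_ne_zero δ0 hT0
  have l0 : ql x 0 = e := by
    simp only [ql, Matrix.cons_val, m0, m1, m2, k1, k2, ← hδ, he]; ring
  have l1 : ql x 1 = 0 := by
    simp only [ql, Matrix.cons_val, m0, m1, m2, k1, k2, k0]; ring
  obtain ⟨f, hf⟩ : ∃ f, f = 2 * T 4 * e := ⟨_, rfl⟩
  have f0 : f ≠ 0 := by rw [hf]; simp [hT4, e0]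
  have p0 : qp x 0 = 0 := by simp only [qp, Matrix.cons_val, m1, l1]; ring
  have p1 : qp x 1 = f := by simp only [qp, Matrix.cons_val, m1, m2, l0, l1, hf]; ring
  have hF : qF x = !![e, 0; 0, f] := by simp [qF, l0, l1, p0, p1]
  have hZ : qZ x = fun p => (![f ^ 3, e * f ^ 2, e ^ 2 * f, e ^ 3] : Fin 4 → ℂ) p.2 * x p := by
    rw [qZ, hF, qR_diag]
  have K1 : qker (qZ x) 1 = f ^ 3 * (e ^ 2 * f) * e ^ 3 * (T 0 * δ) := by
    rw [← k1]; simp only [qker, hZ, qdet_s, Matrix.cons_val]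
  have K2 : qker (qZ x) 2 = f ^ 3 * (e * f ^ 2) * e ^ 3 * δ := by
    rw [← k2]; simp only [qker, hZ, qdet_s, Matrix.cons_val]; ring
  have K3 : qker (qZ x) 3 = f ^ 3 * (e * f ^ 2) * (e ^ 2 * f) * δ := by
    rw [hδ]; simp only [qker, hZ, qdet_s, Matrix.cons_val]
  have M0 : qm (qZ x) 0 = e ^ 2 * f ^ 4 := by
    have : qm (qZ x) 0 = e ^ 2 * f ^ 4 * qm x 0 := by
      simp only [qm, hZ, qgram_s, Matrix.cons_val]; ring
    rw [this, m0, mul_one]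
  have M2 : qm (qZ x) 2 = e ^ 4 * f ^ 2 * T 4 := by
    rw [← m2]
    simp only [qm, hZ, qgram_s, Matrix.cons_val]; ring
  have G0 : qgram (qZ x) 0 0 = f ^ 6 * T 1 := by
    rw [← g00]; simp only [hZ, qgram_s, Matrix.cons_val]; ring
  have G1 : qgram (qZ x) 0 1 = e * f ^ 5 * T 2 := by
    rw [← g01]; simp only [hZ, qgram_s, Matrix.cons_val]; ring
  have G2 : qgram (qZ x) 0 2 = e ^ 2 * f ^ 4 * T 3 := by
    rw [← g02]; simp only [hZ, qgram_s, Matrix.cons_val]; ring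
  refine ⟨x, ?_, ?_, ?_, ?_, ?_⟩
  · rw [hF]; simp [qdt, e0, f0]
  · rw [K2]; simp [e0, f0, δ0]
  · rw [K3]; simp [e0, f0, δ0]
  · rw [M0]; simp [e0, f0]
  · intro k
    fin_cases k <;> simp only [Fin.zero_eta, Fin.mk_one, Fin.reduceFinMk, qn, qd, Matrix.cons_val,
      K1, K2, K3, M0, M2, G0, G1, G2] <;> field_simp

lemma qD_map {R S : Type*} [CommRing R] [CommRing S] (f : R →+* S) (T : Fin 5 → R) :
    f (qD T) = qD (fun k => f (T k)) := by
  simp [qD, qNf, map_ofNat]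

def qT0 : Fin 5 → ℂ := ![1, 0, 1, 0, 1]

lemma qD_T0 : qD qT0 ≠ 0 := by
  simp [qD, qNf, qT0]; norm_num
end dom
universe u
section emb
open IntermediateField

lemma q_amalg {L K Ω : Type u} [Field L] [Field K] [Field Ω] [Algebra L K] (τ : L →+* Ω) :
    ∃ (Ω' : Type u) (_ : Field Ω') (_ : IsAlgClosed Ω') (i : Ω →+* Ω') (j : K →+* Ω'),
      ∀ a : L, j (algebraMap L K a) = i (τ a) := by
  let _ : Algebra L Ω := τ.toAlgebra
  obtain ⟨I, hI⟩ := Ideal.exists_maximal (TensorProduct L K Ω)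
  let _ : Field (TensorProduct L K Ω ⧸ I) := Ideal.Quotient.field I
  refine ⟨AlgebraicClosure (TensorProduct L K Ω ⧸ I), inferInstance, inferInstance,
    ((algebraMap _ _).comp (Ideal.Quotient.mk I)).comp
      (Algebra.TensorProduct.includeRight : Ω →ₐ[L] TensorProduct L K Ω).toRingHom,
    ((algebraMap _ _).comp (Ideal.Quotient.mk I)).comp
      (Algebra.TensorProduct.includeLeft : K →ₐ[L] TensorProduct L K Ω).toRingHom, ?_⟩
  intro a
  have h1 := (Algebra.TensorProduct.includeLeft : K →ₐ[L] TensorProduct L K Ω).commutes a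
  have h2 := (Algebra.TensorProduct.includeRight : Ω →ₐ[L] TensorProduct L K Ω).commutes a
  have h3 : algebraMap L Ω a = τ a := rfl
  rw [h3] at h2
  have : (Algebra.TensorProduct.includeLeft : K →ₐ[L] TensorProduct L K Ω) (algebraMap L K a) =
    (Algebra.TensorProduct.includeRight : Ω →ₐ[L] TensorProduct L K Ω) (τ a) := by rw [h1, h2]
  exact congrArg (fun z => algebraMap (TensorProduct L K Ω ⧸ I) (AlgebraicClosure (TensorProduct L K Ω ⧸ I)) (Ideal.Quotient.mk I z)) this

lemma q_exists_tau {k K : Type u} [Field k] [Field K] [Algebra k K] [CharZero k]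
    (E : IntermediateField k K) (h : K) (hh : h ∉ E) :
    ∃ τ : E⟮h⟯ →ₐ[E] AlgebraicClosure K,
      τ (AdjoinSimple.gen E h) ≠ algebraMap K (AlgebraicClosure K) h := by
  by_cases hi : IsIntegral E h
  · have hsep : (minpoly E h).Separable := (minpoly.irreducible hi).separable
    have hdeg : (minpoly E h).natDegree ≠ 1 := by
      intro h1
      have := (minpoly.natDegree_eq_one_iff).1 h1
      obtain ⟨e, he⟩ := this
      exact hh (he ▸ e.2)
    by_contra hcon
    push Not at hcon
    let _ : Fintype (E⟮h⟯ →ₐ[E] AlgebraicClosure K) := fintypeOfAlgHomAdjoinIntegral E hi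
    have hcard : Nat.card (E⟮h⟯ →ₐ[E] AlgebraicClosure K) = (minpoly E h).natDegree :=
      card_algHom_adjoin_integral E hi hsep (IsAlgClosed.splits _)
    have : Nat.card (E⟮h⟯ →ₐ[E] AlgebraicClosure K) ≤ 1 := by
      rw [Nat.card_eq_fintype_card, Fintype.card_le_one_iff_subsingleton]
      refine ⟨fun a b => ?_⟩
      apply (adjoin.powerBasis hi).algHom_ext
      rw [adjoin.powerBasis_gen, hcon a, hcon b]
    have hpos := minpoly.natDegree_pos hi
    omega
  · have ht : Transcendental E h := fun ha => hi ha.isIntegral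
    have ht1 : Transcendental E (h + 1) := by
      intro ha
      apply ht
      have := ha.sub (isAlgebraic_one (R := E) (A := K))
      simpa using this
    let e1 := RatFunc.algEquivOfTranscendental h ht
    let e2 := RatFunc.algEquivOfTranscendental (h + 1) ht1
    refine ⟨((IsScalarTower.toAlgHom E K (AlgebraicClosure K)).comp (E⟮h + 1⟯).val).comp
      ((e1.symm.trans e2 : E⟮h⟯ ≃ₐ[E] E⟮h + 1⟯) : E⟮h⟯ →ₐ[E] E⟮h + 1⟯), ?_⟩
    have h1 : e1 RatFunc.X = AdjoinSimple.gen E h := Subtype.ext (RatFunc.algEquivOfTranscendental_X h ht)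
    have h2 : e2 RatFunc.X = AdjoinSimple.gen E (h + 1) :=
      Subtype.ext (RatFunc.algEquivOfTranscendental_X (h + 1) ht1)
    have h3 : e1.symm (AdjoinSimple.gen E h) = RatFunc.X := by
      rw [← h1, AlgEquiv.symm_apply_apply]
    simp [h3, h2]
end emb
section act

lemma q_coeff (i j i' j' : ℕ) (c : ℂ) :
    coeff (Finsupp.single (0 : Fin 2) i + Finsupp.single 1 j)
      (C c * (X 0 ^ i' * X 1 ^ j') : MvPolynomial (Fin 2) ℂ) = if i' = i ∧ j' = j then c else 0 := by
  have h : (C c * (X 0 ^ i' * X 1 ^ j') : MvPolynomial (Fin 2) ℂ)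
      = monomial (Finsupp.single 0 i' + Finsupp.single 1 j') c := by
    rw [X_pow_eq_monomial, X_pow_eq_monomial, monomial_mul, C_mul_monomial]; simp
  rw [h, coeff_monomial]
  congr 1
  apply propext
  constructor
  · intro h
    have h0 := DFunLike.congr_fun h 0
    have h1 := DFunLike.congr_fun h 1
    simp at h0 h1
    exact ⟨h0, h1⟩
  · rintro ⟨rfl, rfl⟩; rfl

lemma q_C2 : (C 2 : MvPolynomial (Fin 2) ℂ) = 2 := map_ofNat C 2
lemma q_C3 : (C 3 : MvPolynomial (Fin 2) ℂ) = 3 := map_ofNat C 3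

lemma repMat_two (g : SL2) (i j : Fin 3) : repMat 2 g i j = qsym2 g.1 i j := by
  have h : sub1 g (X 0 ^ (j : ℕ) * X 1 ^ (2 - (j : ℕ))) =
      ∑ a : Fin 3, C (qsym2 g.1 a j) * (X 0 ^ (a : ℕ) * X 1 ^ (2 - (a : ℕ))) := by
    fin_cases j <;> simp [sub1, qsym2, Fin.sum_univ_three, Fin.sum_univ_two, q_C2, q_C3] <;> ring
  rw [repMat, h, coeff_sum]
  simp only [q_coeff]
  rw [Finset.sum_eq_single i]
  · simp
  · intro b _ hb
    rw [if_neg]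
    rintro ⟨h, -⟩
    exact hb (Fin.ext h)
  · simp

lemma repMat_three (g : SL2) (i j : Fin 4) : repMat 3 g i j = qsym3 g.1 i j := by
  have h : sub1 g (X 0 ^ (j : ℕ) * X 1 ^ (3 - (j : ℕ))) =
      ∑ a : Fin 4, C (qsym3 g.1 a j) * (X 0 ^ (a : ℕ) * X 1 ^ (3 - (a : ℕ))) := by
    fin_cases j <;> simp [sub1, qsym3, Fin.sum_univ_four, Fin.sum_univ_two, q_C2, q_C3] <;> ring
  rw [repMat, h, coeff_sum]
  simp only [q_coeff]
  rw [Finset.sum_eq_single i]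
  · simp
  · intro b _ hb
    rw [if_neg]
    rintro ⟨h, -⟩
    exact hb (Fin.ext h)
  · simp

lemma q_coord (g h : SL2) (t : ℂˣ) (p : Fin 3 × Fin 4) :
    coordHomAB 2 3 g h t (X p) =
      C (t : ℂ) * qL (g.1.map C) (qR (h.1.map C) X) p := by
  rw [coordHomAB, aeval_X, smul_eq_C_mul]
  congr 1
  simp only [qL, qR, qA, ← qsym2_map, ← qsym3_map, Finset.mul_sum, repMat_two, repMat_three,
    Fintype.sum_prod_type, C_mul, mul_assoc]
end act
section ext

lemma qL_map {R S : Type*} [CommRing R] [CommRing S] (f : R →+* S)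
    (g : Matrix (Fin 2) (Fin 2) R) (x : Fin 3 × Fin 4 → R) (p) :
    f (qL g x p) = qL (g.map f) (fun p => f (x p)) p := by
  simp [qL, qsym2_map]

lemma qR_map {R S : Type*} [CommRing R] [CommRing S] (f : R →+* S)
    (g : Matrix (Fin 2) (Fin 2) R) (x : Fin 3 × Fin 4 → R) (p) :
    f (qR g x p) = qR (g.map f) (fun p => f (x p)) p := by
  simp [qR, qA, qsym3_map]

lemma qLR_map {R S : Type*} [CommRing R] [CommRing S] (f : R →+* S) (t : R)
    (g h : Matrix (Fin 2) (Fin 2) R) (x : Fin 3 × Fin 4 → R) (p) :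
    f (t * qL g (qR h x) p) = f t * qL (g.map f) (qR (h.map f) (fun p => f (x p))) p := by
  rw [map_mul, qL_map]
  congr 2
  funext q
  exact qR_map f h x q

lemma qsym2_smul {R : Type*} [CommRing R] (a : R) (g : Matrix (Fin 2) (Fin 2) R) (i j) :
    qsym2 (a • g) i j = a ^ 2 * qsym2 g i j := by
  fin_cases i <;> fin_cases j <;> simp [qsym2] <;> ring

lemma qsym3_smul {R : Type*} [CommRing R] (a : R) (g : Matrix (Fin 2) (Fin 2) R) (i j) :
    qsym3 (a • g) i j = a ^ 3 * qsym3 g i j := by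
  fin_cases i <;> fin_cases j <;> simp [qsym3] <;> ring

lemma qLR_smul {R : Type*} [CommRing R] (a b : R) (g h : Matrix (Fin 2) (Fin 2) R)
    (x : Fin 3 × Fin 4 → R) (p) :
    qL (a • g) (qR (b • h) x) p = a ^ 2 * b ^ 3 * qL g (qR h x) p := by
  simp only [qL, qR, qA, qsym2_smul, qsym3_smul, Finset.mul_sum]
  refine Finset.sum_congr rfl fun i _ => Finset.sum_congr rfl fun j _ => ?_
  ring

lemma q_scale (a : Matrix (Fin 2) (Fin 2) ℂ) (ha : qdt a ≠ 0) :
    ∃ (α : ℂ) (g : SL2), α ≠ 0 ∧ a = α • g.1 := by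
  obtain ⟨α, hα⟩ := IsAlgClosed.exists_pow_nat_eq (qdt a) (n := 2) (by norm_num)
  have h0 : α ≠ 0 := by rintro rfl; apply ha; rw [← hα]; simp
  refine ⟨α, ⟨α⁻¹ • a, ?_⟩, h0, ?_⟩
  · rw [Matrix.det_fin_two]
    simp only [Matrix.smul_apply, smul_eq_mul]
    have : a 0 0 * a 1 1 - a 0 1 * a 1 0 = α ^ 2 := by rw [hα, qdt]
    field_simp
    linear_combination this
  · simp [smul_smul, h0]

lemma q_invC (f g : MvPolynomial (Fin 3 × Fin 4) ℂ)
    (H : ∀ γ : SL2 × SL2 × ℂˣ, coordHomAB 2 3 γ.1 γ.2.1 γ.2.2 f * g =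
      coordHomAB 2 3 γ.1 γ.2.1 γ.2.2 g * f)
    (a b : Matrix (Fin 2) (Fin 2) ℂ) (t : ℂ) (ha : qdt a ≠ 0) (hb : qdt b ≠ 0) (ht : t ≠ 0)
    (x : Fin 3 × Fin 4 → ℂ) :
    eval (fun p => t * qL a (qR b x) p) f * eval x g =
      eval (fun p => t * qL a (qR b x) p) g * eval x f := by
  obtain ⟨α, a, hα, rfl⟩ := q_scale a ha
  obtain ⟨β, b, hβ, rfl⟩ := q_scale b hb
  have hs : t * (α ^ 2 * β ^ 3) ≠ 0 := by positivity
  have key : ∀ f : MvPolynomial (Fin 3 × Fin 4) ℂ,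
      eval x (coordHomAB 2 3 a b (Units.mk0 _ hs) f) =
      eval (fun p => t * qL (α • a.1) (qR (β • b.1) x) p) f := by
    intro f
    have : ((eval x).comp (coordHomAB 2 3 a b (Units.mk0 _ hs)).toRingHom) =
      eval (fun p => t * qL (α • a.1) (qR (β • b.1) x) p) := by
      apply MvPolynomial.ringHom_ext
      · intro r
        simp [coordHomAB]
      · intro p
        have h1 : (coordHomAB 2 3 a b (Units.mk0 _ hs)).toRingHom (X p) = _ := q_coord a b _ p
        rw [RingHom.comp_apply, h1, qLR_map, eval_X, qLR_smul]
        have h2 : ∀ m : Matrix (Fin 2) (Fin 2) ℂ, (m.map (C : ℂ → MvPolynomial (Fin 3 × Fin 4) ℂ)).map (eval x) = m := by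
          intro m; ext i j; simp
        simp only [h2]
        simp
        ring
    exact DFunLike.congr_fun this f
  have := congrArg (eval x) (H (a, b, Units.mk0 _ hs))
  rw [map_mul, map_mul, key, key] at this
  exact this

lemma q_ext {Ω : Type*} [Field Ω] (f g : MvPolynomial (Fin 3 × Fin 4) ℂ)
    (H : ∀ γ : SL2 × SL2 × ℂˣ, coordHomAB 2 3 γ.1 γ.2.1 γ.2.2 f * g =
      coordHomAB 2 3 γ.1 γ.2.1 γ.2.2 g * f)
    (φ ψ : MvPolynomial (Fin 3 × Fin 4) ℂ →+* Ω) (hC : ∀ c, ψ (C c) = φ (C c))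
    (a b : Matrix (Fin 2) (Fin 2) Ω) (t : Ω)
    (hX : ∀ p, ψ (X p) = t * qL a (qR b (fun p => φ (X p))) p) :
    ψ f * φ g = ψ g * φ f := by
  let σ := ((Fin 2 × Fin 2) ⊕ (Fin 2 × Fin 2)) ⊕ (Unit ⊕ (Fin 3 × Fin 4))
  let A : Matrix (Fin 2) (Fin 2) (MvPolynomial σ ℂ) := fun i j => X (.inl (.inl (i, j)))
  let B : Matrix (Fin 2) (Fin 2) (MvPolynomial σ ℂ) := fun i j => X (.inl (.inr (i, j)))
  let T : MvPolynomial σ ℂ := X (.inr (.inl ()))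
  let Z : Fin 3 × Fin 4 → MvPolynomial σ ℂ := fun p => X (.inr (.inr p))
  let Y : Fin 3 × Fin 4 → MvPolynomial σ ℂ := fun p => T * qL A (qR B Z) p
  let W : MvPolynomial σ ℂ := aeval Y f * aeval Z g - aeval Y g * aeval Z f
  have hW : W * (T * qdt A * qdt B) = 0 := by
    apply MvPolynomial.funext
    intro v
    rw [map_zero, map_mul]
    by_cases h0 : eval v (T * qdt A * qdt B) = 0
    · rw [h0, mul_zero]
    have hA : eval v (qdt A) = qdt (A.map (eval v)) := by simp [qdt]
    have hB : eval v (qdt B) = qdt (B.map (eval v)) := by simp [qdt]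
    rw [map_mul, map_mul, hA, hB] at h0
    have h1 := q_invC f g H (A.map (eval v)) (B.map (eval v)) (eval v T)
      (fun h => h0 (by rw [h]; ring)) (fun h => h0 (by rw [h]; ring))
      (fun h => h0 (by rw [h]; ring)) (fun p => eval v (Z p))
    have hY : ∀ f : MvPolynomial (Fin 3 × Fin 4) ℂ, eval v (aeval Y f) =
        eval (fun p => eval v T * qL (A.map (eval v)) (qR (B.map (eval v)) (fun p => eval v (Z p))) p) f := by
      intro f
      have : (eval v).comp (aeval Y).toRingHom = eval (fun p => eval v T * qL (A.map (eval v)) (qR (B.map (eval v)) (fun p => eval v (Z p))) p) := by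
        apply MvPolynomial.ringHom_ext
        · intro r; simp
        · intro p
          rw [eval_X, ← qLR_map]
          simp [Y]
      exact DFunLike.congr_fun this f
    have hZ : ∀ f : MvPolynomial (Fin 3 × Fin 4) ℂ, eval v (aeval Z f) =
        eval (fun p => eval v (Z p)) f := by
      intro f
      have : (eval v).comp (aeval Z).toRingHom = eval (fun p => eval v (Z p)) := by
        apply MvPolynomial.ringHom_ext
        · intro r; simp
        · intro p
          simp
      exact DFunLike.congr_fun this f
    have : eval v W = 0 := by
      simp only [W, map_sub, map_mul, hY, hZ]
      rw [h1, sub_self]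
    rw [this, zero_mul]
  have hT : T * qdt A * qdt B ≠ 0 := by
    intro h
    let v : σ → ℂ := Sum.elim (Sum.elim (fun p => if p.1 = p.2 then 1 else 0)
      (fun p => if p.1 = p.2 then 1 else 0)) (Sum.elim (fun _ => 1) (fun _ => 0))
    have := congrArg (eval v) h
    simp [qdt, A, B, T, v] at this
  have hW0 : W = 0 := by
    rcases mul_eq_zero.1 hW with h | h
    · exact h
    · exact absurd h hT
  let v : σ → Ω := Sum.elim (Sum.elim (fun p => a p.1 p.2) (fun p => b p.1 p.2))
    (Sum.elim (fun _ => t) (fun p => φ (X p)))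
  let e : MvPolynomial σ ℂ →+* Ω := eval₂Hom (φ.comp C) v
  have hAe : A.map e = a := by ext i j; rw [Matrix.map_apply]; simp [A, e, v]
  have hBe : B.map e = b := by ext i j; rw [Matrix.map_apply]; simp [B, e, v]
  have hTe : e T = t := by simp [T, e, v]
  have hZe : ∀ p, e (Z p) = φ (X p) := by intro p; simp [Z, e, v]
  have hZ : ∀ f, e (aeval Z f) = φ f := by
    intro f
    have : e.comp (aeval Z).toRingHom = φ := by
      apply MvPolynomial.ringHom_ext
      · intro r; simp [e]
      · intro p
        simp [hZe]
    exact DFunLike.congr_fun this f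
  have hY : ∀ f, e (aeval Y f) = ψ f := by
    intro f
    have : e.comp (aeval Y).toRingHom = ψ := by
      apply MvPolynomial.ringHom_ext
      · intro r; simp [e, hC]
      · intro p
        have : e (Y p) = ψ (X p) := by
          simp only [Y]
          rw [qLR_map, hAe, hBe, hTe, hX]
          simp only [hZe]
        simpa using this
    exact DFunLike.congr_fun this f
  have := congrArg e hW0
  simp only [W, map_sub, map_mul, hY, hZ, map_zero] at this
  exact sub_eq_zero.1 this
end ext
section fin
open IntermediateField

abbrev QP := MvPolynomial (Fin 3 × Fin 4) ℂ
abbrev QK := FractionRing (MvPolynomial (Fin 3 × Fin 4) ℂ)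

def qI (k : Fin 5) : QK := algebraMap QP QK (qn X k) / algebraMap QP QK (qd X k)

lemma q_qd_ne {R : Type*} [Field R] (x : Fin 3 × Fin 4 → R) (h2 : qker (qZ x) 2 ≠ 0)
    (h3 : qker (qZ x) 3 ≠ 0) (h0 : qm (qZ x) 0 ≠ 0) (k) : qd x k ≠ 0 := by
  fin_cases k <;> simp [qd, h2, h3, h0]

lemma q_gen {Ω : Type*} [Field Ω] (φ : QP →+* Ω) (hφ : Function.Injective φ) :
    qdt (qF fun p => φ (X p)) ≠ 0 ∧ qker (qZ fun p => φ (X p)) 2 ≠ 0 ∧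
    qker (qZ fun p => φ (X p)) 3 ≠ 0 ∧ qm (qZ fun p => φ (X p)) 0 ≠ 0 := by
  obtain ⟨x, h1, h2, h3, h4, -⟩ := q_dom qT0 qD_T0
  have e1 : ∀ {S : Type _} [CommRing S] (φ : QP →+* S),
      qdt (qF fun p => φ (X p)) = φ (qdt (qF X)) := by
    intro S _ φ; simp [qdt, qF_map]
  have e2 : ∀ {S : Type _} [CommRing S] (φ : QP →+* S) (i),
      qker (qZ fun p => φ (X p)) i = φ (qker (qZ X) i) := by
    intro S _ φ i; rw [qker_map, qZ_map']
  have e3 : ∀ {S : Type _} [CommRing S] (φ : QP →+* S) (i),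
      qm (qZ fun p => φ (X p)) i = φ (qm (qZ X) i) := by
    intro S _ φ i; rw [qm_map, qZ_map']
  have hx : x = fun p => eval x (X p) := by funext p; simp
  have z : ∀ P : QP, eval x P ≠ 0 → φ P ≠ 0 := by
    intro P hP h
    apply hP
    rw [(map_eq_zero_iff φ hφ).1 h, map_zero]
  refine ⟨?_, ?_, ?_, ?_⟩
  · rw [e1]; apply z; simpa [qdt, qF_map] using h1
  · rw [e2]; apply z; rw [qker_map, qZ_map']; simpa using h2
  · rw [e2]; apply z; rw [qker_map, qZ_map']; simpa using h3
  · rw [e3]; apply z; rw [qm_map, qZ_map']; simpa using h4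

lemma q_qdX (k) : (qd X k : QP) ≠ 0 := by
  obtain ⟨x, h1, h2, h3, h4, -⟩ := q_dom qT0 qD_T0
  intro h
  have := congrArg (eval x) h
  rw [qd_map, map_zero] at this
  simp only [eval_X] at this
  exact q_qd_ne x h2 h3 h4 k this

lemma qI_mem (k) : qI k ∈ invFieldAB 2 3 := by
  refine ⟨qn X k, qd X k, q_qdX k, rfl, ?_⟩
  rintro ⟨g, h, t⟩
  have hdet : ∀ g : SL2, qdt (g.1.map (C : ℂ → QP)) = 1 := by
    intro g
    have := g.2
    rw [Matrix.det_fin_two] at this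
    simp only [qdt, Matrix.map_apply, ← C_mul, ← C_sub, this, C_1]
  have h1 : coordHomAB 2 3 g h t (qn X k) =
      qn (fun p => C (t : ℂ) * qL (g.1.map C) (qR (h.1.map C) (X : _ → QP)) p) k := by
    refine (qn_map (coordHomAB 2 3 g h t).toRingHom X k).trans ?_
    congr 1
    funext p
    exact q_coord g h t p
  have h2 : coordHomAB 2 3 g h t (qd X k) =
      qd (fun p => C (t : ℂ) * qL (g.1.map C) (qR (h.1.map C) (X : _ → QP)) p) k := by
    refine (qd_map (coordHomAB 2 3 g h t).toRingHom X k).trans ?_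
    congr 1
    funext p
    exact q_coord g h t p
  have := qnd_inv (g.1.map C) (h.1.map C) (hdet g) (hdet h) (C (t : ℂ)) (X : _ → QP) k
  change coordHomAB 2 3 g h t (qn X k) * qd X k = coordHomAB 2 3 g h t (qd X k) * qn X k
  rw [h1, h2]
  exact this

lemma qI_map {Ω : Type*} [Field Ω] (j : QK →+* Ω) (k) :
    j (qI k) = qn (fun p => j (algebraMap QP QK (X p))) k /
      qd (fun p => j (algebraMap QP QK (X p))) k := by
  rw [qI, map_div₀]
  congr 1
  · exact qn_map (j.comp (algebraMap QP QK)) X k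
  · exact qd_map (j.comp (algebraMap QP QK)) X k

lemma q_inv_le : invFieldAB 2 3 ≤ adjoin ℂ (Set.range qI) := by
  intro h hh
  by_contra hcon
  obtain ⟨f, g, hg, hfg, H⟩ := hh
  obtain ⟨τ, hτ⟩ := q_exists_tau (adjoin ℂ (Set.range qI)) h hcon
  obtain ⟨Ω, _, _, i, j2, hj⟩ := q_amalg
    (K := QK) τ.toRingHom
  let j1 : QK →+* Ω := i.comp (algebraMap QK (AlgebraicClosure QK))
  have hE : ∀ e : adjoin ℂ (Set.range qI), j2 e = j1 e := by
    intro e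
    have := hj (algebraMap _ _ e)
    refine this.trans ?_
    change i (τ (algebraMap _ _ e)) = i _
    rw [τ.commutes]
    rfl
  have hne : j2 h ≠ j1 h := by
    have : j2 h = i (τ (AdjoinSimple.gen _ h)) := hj (AdjoinSimple.gen _ h)
    rw [this]
    intro h'
    exact hτ (i.injective h')
  have hchar : CharZero Ω := charZero_of_injective_ringHom (j1.comp (algebraMap ℂ QK)).injective
  let φ : QP →+* Ω := j1.comp (algebraMap QP QK)
  let ψ : QP →+* Ω := j2.comp (algebraMap QP QK)
  have hφ : Function.Injective φ := j1.injective.comp (IsFractionRing.injective QP QK)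
  have hψ : Function.Injective ψ := j2.injective.comp (IsFractionRing.injective QP QK)
  obtain ⟨a1, a2, a3, a4⟩ := q_gen φ hφ
  obtain ⟨b1, b2, b3, b4⟩ := q_gen ψ hψ
  have hI : ∀ k, qn (fun p => φ (X p)) k / qd (fun p => φ (X p)) k =
      qn (fun p => ψ (X p)) k / qd (fun p => ψ (X p)) k := by
    intro k
    have h1 := qI_map j1 k
    have h2 := qI_map j2 k
    have h3 := hE ⟨qI k, subset_adjoin _ _ ⟨k, rfl⟩⟩
    exact h1.symm.trans (h3.symm.trans h2)
  obtain ⟨a, b, t, hy⟩ := q_sep (fun p => φ (X p)) (fun p => ψ (X p)) a1 a2 a3 a4 b1 b2 b3 b4 hI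
  have hC : ∀ c, ψ (C c) = φ (C c) := by
    intro c
    have h1 : algebraMap QP QK (C c) = algebraMap ℂ QK c := by
      rw [IsScalarTower.algebraMap_apply ℂ QP QK]; rfl
    have := hE (algebraMap ℂ _ c)
    change j2 (algebraMap QP QK (C c)) = j1 (algebraMap QP QK (C c))
    rw [h1]
    exact this
  have key := q_ext f g H φ ψ hC a b t (fun p => congrFun hy p)
  apply hne
  have hg1 : φ g ≠ 0 := fun h => hg ((map_eq_zero_iff φ hφ).1 h)
  have hg2 : ψ g ≠ 0 := fun h => hg ((map_eq_zero_iff ψ hψ).1 h)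
  have h1 : j1 h = φ f / φ g := by rw [hfg, map_div₀]; rfl
  have h2 : j2 h = ψ f / ψ g := by rw [hfg, map_div₀]; rfl
  rw [h1, h2, div_eq_div_iff hg2 hg1, key]
  ring

lemma q_eq : adjoin ℂ (Set.range qI) = invFieldAB 2 3 := by
  apply le_antisymm
  · rw [adjoin_le_iff]
    rintro _ ⟨k, rfl⟩
    exact qI_mem k
  · exact q_inv_le

def qRel (x : Fin 3 × Fin 4 → ℂ) (a : QK) (v : ℂ) : Prop :=
  ∃ P Q : QP, eval x Q ≠ 0 ∧ a * algebraMap QP QK Q = algebraMap QP QK P ∧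
    v * eval x Q = eval x P

lemma qRel_aeval (x : Fin 3 × Fin 4 → ℂ) (hd : ∀ k, qd x k ≠ 0) (r : MvPolynomial (Fin 5) ℂ) :
    qRel x (aeval qI r) (eval (fun k => qn x k / qd x k) r) := by
  induction r using MvPolynomial.induction_on with
  | C c =>
    refine ⟨C c, 1, by simp, ?_, by simp⟩
    rw [map_one, mul_one, aeval_C, IsScalarTower.algebraMap_apply ℂ QP QK]; rfl
  | add p q hp hq =>
    obtain ⟨P, Q, h1, h2, h3⟩ := hp
    obtain ⟨P', Q', h1', h2', h3'⟩ := hq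
    refine ⟨P * Q' + P' * Q, Q * Q', ?_, ?_, ?_⟩
    · rw [map_mul]; exact mul_ne_zero h1 h1'
    · simp only [map_add, map_mul, ← h2, ← h2']; ring
    · simp only [map_add, map_mul, ← h3, ← h3']; ring
  | mul_X p k hp =>
    obtain ⟨P, Q, h1, h2, h3⟩ := hp
    have e1 : eval x (qn X k) = qn x k := by rw [qn_map]; simp
    have e2 : eval x (qd X k) = qd x k := by rw [qd_map]; simp
    have hk : algebraMap QP QK (qd X k) ≠ 0 := fun h =>
      q_qdX k ((map_eq_zero_iff _ (IsFractionRing.injective QP QK)).1 h)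
    refine ⟨P * qn X k, Q * qd X k, ?_, ?_, ?_⟩
    · rw [map_mul, e2]; exact mul_ne_zero h1 (hd k)
    · simp only [map_mul, aeval_X, qI, ← h2]; field_simp
    · have := hd k
      simp only [map_mul, eval_X, ← h3, e1, e2]; field_simp

lemma q_algInd : AlgebraicIndependent ℂ qI := by
  rw [algebraicIndependent_iff]
  intro r hr
  have h0 : (qD X : MvPolynomial (Fin 5) ℂ) ≠ 0 := by
    intro h
    apply qD_T0
    have := congrArg (eval qT0) h
    rw [qD_map, map_zero] at this
    simpa using this
  have h1 : r * qD X = 0 := by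
    apply MvPolynomial.funext
    intro T
    have e : eval T (qD X) = qD T := by rw [qD_map]; simp
    rw [map_mul, map_zero, e]
    by_cases hD : qD T = 0
    · rw [hD, mul_zero]
    obtain ⟨x, -, h2, h3, h4, h5⟩ := q_dom T hD
    have hd := q_qd_ne x h2 h3 h4
    obtain ⟨P, Q, g1, g2, g3⟩ := qRel_aeval x hd r
    rw [hr, zero_mul] at g2
    have hP : P = 0 := (map_eq_zero_iff _ (IsFractionRing.injective QP QK)).1 g2.symm
    rw [hP, map_zero] at g3
    have hT : (fun k => qn x k / qd x k) = T := funext h5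
    rw [hT] at g3
    rcases mul_eq_zero.1 g3 with h | h
    · rw [h, zero_mul]
    · exact absurd h g1
  rcases mul_eq_zero.1 h1 with h | h
  · exact h
  · exact absurd h h0
end fin

/-- **Rationality of `P(V_{2,3}) / (SL₂(ℂ) × SL₂(ℂ))`**: the field of invariant rational
functions is purely transcendental over `ℂ` of transcendence degree 5. -/
theorem quotient_rational_2_3 :
    Nonempty ((invFieldAB 2 3) ≃ₐ[ℂ] FractionRing (MvPolynomial (Fin 5) ℂ)) := by
  exact ⟨(IntermediateField.equivOfEq q_eq).symm.trans q_algInd.aevalEquivField.symm⟩
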